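/- arXiv:2210.11315 — 4 statements merged into one kernel-verified Lean document; each statement's English description precedes it below -/
import Mathlib

section
/- (Comparative statics in Theorem 2a.) Let σ > 0 and κ ∈ (0,1). Suppose θ : I → (0,1) is a differentiable function on an open interval I ⊆ (0,∞) satisfying λ·g(θ(λ)) = −log κ for all λ ∈ I. Then for every λ ∈ I, θ′(λ) = (log κ)/(λ²·h(θ(λ))) < 0; that is, larger news-arrival rates produce shorter initial candid periods. -/
/-- The standard normal cumulative distribution function
`Φ(x) = (1/√(2π)) ∫_{-∞}^x e^{-u²/2} du`. -/
noncomputable def Phi (x : ℝ) : ℝ :=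
  (Real.sqrt (2 * Real.pi))⁻¹ * ∫ u in Set.Iic x, Real.exp (-u ^ 2 / 2)

/-- The discount function `h(t) = 2Φ(σ(1-t)/2) - 1` for volatility `σ`. -/
noncomputable def h (σ t : ℝ) : ℝ := 2 * Phi (σ * (1 - t) / 2) - 1

/-- `g(t) = ∫₀ᵗ h(u) du`. -/
noncomputable def g (σ t : ℝ) : ℝ := ∫ u in (0:ℝ)..t, h σ u

/-- The explicit derivative of `h`: `h′(t) = -(σ/√(2π))·exp(-σ²(1-t)²/8)`. -/
noncomputable def hDeriv (σ t : ℝ) : ℝ :=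
  -(σ / Real.sqrt (2 * Real.pi)) * Real.exp (-(σ ^ 2 * (1 - t) ^ 2) / 8)

lemma aux_integrable : MeasureTheory.Integrable (fun u : ℝ => Real.exp (-u ^ 2 / 2)) := by
  have := integrable_exp_neg_mul_sq (b := 1/2) (by norm_num)
  refine this.congr (Filter.Eventually.of_forall fun u => ?_)
  simp only
  congr 1
  ring

lemma aux_zero : ∫ u in Set.Iic (0:ℝ), Real.exp (-u ^ 2 / 2) = Real.sqrt (2 * Real.pi) / 2 := by
  have h1 := integral_comp_neg_Iic (0:ℝ) (fun u : ℝ => Real.exp (-u ^ 2 / 2))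
  have h2 := integral_gaussian_Ioi (1/2)
  simp only [even_two, Even.neg_pow, neg_zero] at h1
  rw [h1]
  have h3 : ∀ u : ℝ, Real.exp (-u ^ 2 / 2) = Real.exp (-(1/2) * u ^ 2) := by
    intro u
    congr 1
    ring
  simp only [h3]
  rw [h2]
  congr 2
  ring

lemma aux_Phi (x : ℝ) : 2 * Phi x - 1 =
    2 * (Real.sqrt (2 * Real.pi))⁻¹ * ∫ u in (0:ℝ)..x, Real.exp (-u ^ 2 / 2) := by
  have h1 := intervalIntegral.integral_Iic_sub_Iic (a := (0:ℝ)) (b := x)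
    aux_integrable.integrableOn aux_integrable.integrableOn
  have hs : Real.sqrt (2 * Real.pi) ≠ 0 := by positivity
  rw [← h1, aux_zero, Phi]
  field_simp

lemma aux_h_cont (σ : ℝ) : Continuous (h σ) := by
  have h0 : Continuous fun x : ℝ => ∫ u in (0:ℝ)..x, Real.exp (-u ^ 2 / 2) :=
    intervalIntegral.continuous_primitive (fun a b => aux_integrable.intervalIntegrable) 0
  have h1 : h σ = fun t => 2 * (Real.sqrt (2 * Real.pi))⁻¹ *
      ∫ u in (0:ℝ)..(σ * (1 - t) / 2), Real.exp (-u ^ 2 / 2) := by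
    funext t
    exact aux_Phi _
  rw [h1]
  exact continuous_const.mul (h0.comp (by fun_prop))

lemma aux_h_pos (σ t : ℝ) (hσ : 0 < σ) (ht : t < 1) : 0 < h σ t := by
  rw [h, aux_Phi]
  have hx : 0 < σ * (1 - t) / 2 := by
    have : 0 < 1 - t := by linarith
    positivity
  have := intervalIntegral.intervalIntegral_pos_of_pos
    (f := fun u : ℝ => Real.exp (-u ^ 2 / 2)) aux_integrable.intervalIntegrable
    (fun u => Real.exp_pos _) hx
  positivity

/-- Comparative statics in Theorem 2a: if `θ(λ)` is differentiable on an open interval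
`I ⊆ (0,∞)` and satisfies `λ·g(θ(λ)) = -log κ` there, then
`θ′(λ) = (log κ)/(λ² h(θ(λ))) < 0`. -/
theorem stmt_4 (σ κ : ℝ) (hσ : 0 < σ) (hκ : κ ∈ Set.Ioo (0:ℝ) 1)
    (I : Set ℝ) (hIopen : IsOpen I) (hIconn : I.OrdConnected) (hIsub : I ⊆ Set.Ioi (0:ℝ))
    (θ θ' : ℝ → ℝ)
    (hrange : ∀ lam ∈ I, θ lam ∈ Set.Ioo (0:ℝ) 1)
    (hderiv : ∀ lam ∈ I, HasDerivAt θ (θ' lam) lam)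
    (heq : ∀ lam ∈ I, lam * g σ (θ lam) = -Real.log κ) :
    ∀ lam ∈ I, θ' lam = Real.log κ / (lam ^ 2 * h σ (θ lam)) ∧ θ' lam < 0 := by
  intro lam hl
  have hlam : 0 < lam := hIsub hl
  have hpos := aux_h_pos σ (θ lam) hσ (hrange lam hl).2
  have hlog : Real.log κ < 0 := Real.log_neg hκ.1 hκ.2
  have hg : HasDerivAt (g σ) (h σ (θ lam)) (θ lam) :=
    (aux_h_cont σ).integral_hasStrictDerivAt 0 (θ lam) |>.hasDerivAt
  have hd := (hasDerivAt_id lam).mul (hg.comp lam (hderiv lam hl))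
  have hc : HasDerivAt (id * (g σ ∘ θ)) 0 lam := by
    refine (hasDerivAt_const lam (-Real.log κ)).congr_of_eventuallyEq ?_
    filter_upwards [hIopen.mem_nhds hl] with x hx
    simpa using heq x hx
  have hu := hd.unique hc
  simp only [id, Function.comp] at hu
  have he := heq lam hl
  have key : θ' lam = Real.log κ / (lam ^ 2 * h σ (θ lam)) := by
    rw [eq_div_iff (by positivity)]
    linear_combination lam * hu - he
  refine ⟨key, ?_⟩
  rw [key]
  exact div_neg_of_neg_of_pos hlog (by positivity)
end

section
/- (Proposition 3: sign of the co-state variable.) Let σ > 0 and λ > 0. Let π : [0,1] → [0,1], and let α, β : [0,1] → ℝ be continuous with α(t) ≤ β(t) for all t. Suppose μ : [0,1] → ℝ is continuous, piecewise continuously differentiable, satisfies μ(1) = 0, and satisfies the co-state equation μ′(t) = (β(t) − α(t))·(1 − π(t)) + μ(t)·π(t)·λ·h(t) at every point of differentiability. Then μ(t) ≤ 0 for all t ∈ [0,1]. -/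
theorem aux_mono (P : Finset ℝ) : ∀ (f f' : ℝ → ℝ) (a b : ℝ), a ≤ b →
    ContinuousOn f (Set.Icc a b) →
    (∀ t ∈ Set.Ioo a b, t ∉ P → HasDerivAt f (f' t) t ∧ 0 ≤ f' t) → f a ≤ f b := by
  induction P using Finset.induction_on with
  | empty =>
    intro f f' a b hab hc hd
    have hm : MonotoneOn f (Set.Icc a b) := by
      apply monotoneOn_of_deriv_nonneg (convex_Icc a b) hc
      · rw [interior_Icc]
        intro t ht
        exact (hd t ht (by simp)).1.differentiableAt.differentiableWithinAt
      · rw [interior_Icc]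
        intro t ht
        rw [(hd t ht (by simp)).1.deriv]
        exact (hd t ht (by simp)).2
    exact hm (Set.left_mem_Icc.2 hab) (Set.right_mem_Icc.2 hab) hab
  | insert p Q hp ih =>
    intro f f' a b hab hc hd
    by_cases hpm : p ∈ Set.Ioo a b
    · have h1 : f a ≤ f p := by
        apply ih f f' a p hpm.1.le (hc.mono (Set.Icc_subset_Icc le_rfl hpm.2.le))
        intro t ht htQ
        refine hd t ⟨ht.1, ht.2.trans hpm.2⟩ ?_
        simp [htQ, ht.2.ne]
      have h2 : f p ≤ f b := by
        apply ih f f' p b hpm.2.le (hc.mono (Set.Icc_subset_Icc hpm.1.le le_rfl))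
        intro t ht htQ
        refine hd t ⟨hpm.1.trans ht.1, ht.2⟩ ?_
        simp [htQ, ht.1.ne']
      exact h1.trans h2
    · apply ih f f' a b hab hc
      intro t ht htQ
      refine hd t ht ?_
      have : t ≠ p := by rintro rfl; exact hpm ht
      simp [htQ, this]

theorem aux_Phi_s10 (x : ℝ) (hx : 0 ≤ x) : 1 / 2 ≤ Phi x := by
  have hint : MeasureTheory.Integrable (fun u : ℝ => Real.exp (-u ^ 2 / 2)) := by
    have := integrable_exp_neg_mul_sq (b := 1 / 2) (by norm_num)
    refine this.congr (Filter.Eventually.of_forall fun u => ?_)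
    simp only
    congr 1
    ring
  have h0 : ∫ u in Set.Iic (0:ℝ), Real.exp (-u ^ 2 / 2) = Real.sqrt (2 * Real.pi) / 2 := by
    have h1 := integral_comp_neg_Iic (0:ℝ) (fun u : ℝ => Real.exp (-(1/2) * u ^ 2))
    rw [neg_zero, integral_gaussian_Ioi] at h1
    rw [show 2 * Real.pi = Real.pi / (1 / 2) by ring, ← h1]
    congr 1
    ext u
    congr 1
    ring
  have hle : Real.sqrt (2 * Real.pi) / 2 ≤ ∫ u in Set.Iic x, Real.exp (-u ^ 2 / 2) := by
    rw [← h0]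
    apply MeasureTheory.setIntegral_mono_set hint.integrableOn
    · exact Filter.Eventually.of_forall fun u => (Real.exp_pos _).le
    · exact (Set.Iic_subset_Iic.2 hx).eventuallyLE
  have hs : 0 < Real.sqrt (2 * Real.pi) := Real.sqrt_pos.2 (by positivity)
  unfold Phi
  calc (1:ℝ) / 2 = (Real.sqrt (2 * Real.pi))⁻¹ * (Real.sqrt (2 * Real.pi) / 2) := by
        field_simp
    _ ≤ _ := by gcongr

/-- Proposition 3: the co-state variable is nonpositive. `μ` is continuous on `[0,1]`, has
terminal value `μ(1) = 0`, and is piecewise continuously differentiable in the sense of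
satisfying the co-state equation off a finite exceptional set `P`. -/
theorem stmt_10 (σ lam : ℝ) (hσ : 0 < σ) (hlam : 0 < lam)
    (pol α β μ : ℝ → ℝ)
    (hpol : ∀ t ∈ Set.Icc (0:ℝ) 1, pol t ∈ Set.Icc (0:ℝ) 1)
    (hα : ContinuousOn α (Set.Icc 0 1)) (hβ : ContinuousOn β (Set.Icc 0 1))
    (hαβ : ∀ t ∈ Set.Icc (0:ℝ) 1, α t ≤ β t)
    (hμc : ContinuousOn μ (Set.Icc 0 1)) (hμ1 : μ 1 = 0)
    (P : Finset ℝ)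
    (hode : ∀ t ∈ Set.Ioo (0:ℝ) 1, t ∉ P →
      HasDerivAt μ ((β t - α t) * (1 - pol t) + μ t * pol t * lam * h σ t) t) :
    ∀ t ∈ Set.Icc (0:ℝ) 1, μ t ≤ 0 := by
  intro t0 ht0
  by_contra! hpos
  have hsub : Set.Icc t0 1 ⊆ Set.Icc (0:ℝ) 1 := Set.Icc_subset_Icc ht0.1 le_rfl
  have hcl : IsClosed (Set.Icc t0 1 ∩ μ ⁻¹' Set.Iic 0) :=
    (hμc.mono hsub).preimage_isClosed_of_isClosed isClosed_Icc isClosed_Iic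
  have hcomp : IsCompact (Set.Icc t0 1 ∩ μ ⁻¹' Set.Iic 0) :=
    isCompact_Icc.of_isClosed_subset hcl Set.inter_subset_left
  obtain ⟨s, ⟨hs, hs0⟩, hmin⟩ := hcomp.exists_isLeast
    ⟨1, Set.right_mem_Icc.2 ht0.2, by simp [hμ1]⟩
  have hs0' : μ s ≤ 0 := hs0
  have key : μ t0 ≤ μ s := by
    refine aux_mono P μ 
      (fun t => (β t - α t) * (1 - pol t) + μ t * pol t * lam * h σ t) t0 s hs.1 (hμc.mono (Set.Icc_subset_Icc ht0.1 hs.2)) ?_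
    intro t ht htP
    have hti : t ∈ Set.Ioo (0:ℝ) 1 := ⟨ht0.1.trans_lt ht.1, ht.2.trans_le hs.2⟩
    have htc := Set.Ioo_subset_Icc_self hti
    refine ⟨hode t hti htP, ?_⟩
    have hμt : 0 ≤ μ t := by
      by_contra! hneg
      have : s ≤ t := hmin ⟨⟨ht.1.le, hti.2.le⟩, hneg.le⟩
      exact absurd ht.2 this.not_gt
    have hh : 0 ≤ h σ t := by
      have := aux_Phi_s10 (σ * (1 - t) / 2)
        (div_nonneg (mul_nonneg hσ.le (sub_nonneg.2 htc.2)) (by norm_num))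
      unfold h
      linarith
    have hp := hpol t htc
    have := hαβ t htc
    exact add_nonneg (mul_nonneg (sub_nonneg.2 this) (sub_nonneg.2 hp.2))
      (mul_nonneg (mul_nonneg (mul_nonneg hμt hp.1) hlam.le) hh)
  linarith
end

section
/- (Corollary 4: bound on the co-state variable.) Let σ > 0 and λ > 0. Let π : [0,1] → [0,1], and let α ≤ β be real constants. Suppose μ : [0,1] → ℝ is continuous, piecewise continuously differentiable, satisfies μ(1) = 0, and satisfies μ′(t) = (β − α)·(1 − π(t)) + μ(t)·π(t)·λ·h(t) at every point of differentiability. Then 0 ≤ −μ(t) ≤ (β − α)·(1 − t) for all t ∈ [0,1]; in particular |μ| is bounded on [0,1]. -/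
theorem mono_off_finset (f : ℝ → ℝ) (P : Finset ℝ) : ∀ a b : ℝ, a ≤ b →
    ContinuousOn f (Set.Icc a b) →
    (∀ t ∈ Set.Ioo a b, t ∉ P → ∃ d, 0 ≤ d ∧ HasDerivAt f d t) → f a ≤ f b := by
  induction P using Finset.induction_on with
  | empty =>
    intro a b hab hc hd
    have : MonotoneOn f (Set.Icc a b) := by
      apply monotoneOn_of_deriv_nonneg (convex_Icc a b) hc
      · intro x hx
        rw [interior_Icc] at hx
        obtain ⟨d, _, h2⟩ := hd x hx (by simp)
        exact h2.differentiableAt.differentiableWithinAt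
      · intro x hx
        rw [interior_Icc] at hx
        obtain ⟨d, h1, h2⟩ := hd x hx (by simp)
        rw [h2.deriv]; exact h1
    exact this (Set.left_mem_Icc.2 hab) (Set.right_mem_Icc.2 hab) hab
  | insert p P _ ih =>
    intro a b hab hc hd
    by_cases hp : p ∈ Set.Ioo a b
    · refine (ih a p hp.1.le (hc.mono (Set.Icc_subset_Icc_right hp.2.le)) ?_).trans
        (ih p b hp.2.le (hc.mono (Set.Icc_subset_Icc_left hp.1.le)) ?_)
      · intro t ht htP
        refine hd t ⟨ht.1, ht.2.trans hp.2⟩ ?_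
        simp [htP, ht.2.ne]
      · intro t ht htP
        refine hd t ⟨hp.1.trans ht.1, ht.2⟩ ?_
        simp [htP, ht.1.ne']
    · refine ih a b hab hc ?_
      intro t ht htP
      refine hd t ht ?_
      have : t ≠ p := by rintro rfl; exact hp ht
      simp [htP, this]

theorem h_nonneg_aux (σ t : ℝ) (hσ : 0 < σ) (ht : t ≤ 1) : 0 ≤ h σ t := by
  have hx : 0 ≤ σ * (1 - t) / 2 := by
    have : 0 ≤ 1 - t := by linarith
    positivity
  have hint : MeasureTheory.Integrable (fun u : ℝ => Real.exp (-u ^ 2 / 2)) := by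
    have := integrable_exp_neg_mul_sq (b := 1 / 2) (by norm_num)
    refine this.congr (Filter.Eventually.of_forall fun x => ?_)
    simp only; congr 1; ring
  have h0 : ∫ u in Set.Iic (0:ℝ), Real.exp (-u ^ 2 / 2) = Real.sqrt (2 * Real.pi) / 2 := by
    have h1 := integral_comp_neg_Iic (0:ℝ) (fun u : ℝ => Real.exp (-u ^ 2 / 2))
    have h2 := integral_gaussian_Ioi (1 / 2)
    simp only [neg_sq, neg_zero] at h1
    rw [h1]
    have e : Real.pi / (1 / 2) = 2 * Real.pi := by ring
    rw [e] at h2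
    rw [← h2]
    congr 1; funext x; congr 1; ring
  have hle : ∫ u in Set.Iic (0:ℝ), Real.exp (-u ^ 2 / 2)
      ≤ ∫ u in Set.Iic (σ * (1 - t) / 2), Real.exp (-u ^ 2 / 2) := by
    apply MeasureTheory.setIntegral_mono_set hint.integrableOn
    · exact Filter.Eventually.of_forall fun x => (Real.exp_pos _).le
    · exact (Set.Iic_subset_Iic.2 hx).eventuallyLE
  have hs : 0 < Real.sqrt (2 * Real.pi) := Real.sqrt_pos.2 (by positivity)
  rw [h0] at hle
  have : 1 / 2 ≤ Phi (σ * (1 - t) / 2) := by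
    unfold Phi
    calc (1:ℝ) / 2 = (Real.sqrt (2 * Real.pi))⁻¹ * (Real.sqrt (2 * Real.pi) / 2) := by
          field_simp
      _ ≤ _ := mul_le_mul_of_nonneg_left hle (by positivity)
  unfold h; linarith

/-- Corollary 4: with constant pay-for-performance coefficients `α ≤ β`, the co-state variable
satisfies `0 ≤ -μ(t) ≤ (β-α)(1-t)` on `[0,1]`; in particular `|μ|` is bounded. -/
theorem stmt_11 (σ lam α β : ℝ) (hσ : 0 < σ) (hlam : 0 < lam) (hαβ : α ≤ β)
    (pol μ : ℝ → ℝ)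
    (hpol : ∀ t ∈ Set.Icc (0:ℝ) 1, pol t ∈ Set.Icc (0:ℝ) 1)
    (hμc : ContinuousOn μ (Set.Icc 0 1)) (hμ1 : μ 1 = 0)
    (P : Finset ℝ)
    (hode : ∀ t ∈ Set.Ioo (0:ℝ) 1, t ∉ P →
      HasDerivAt μ ((β - α) * (1 - pol t) + μ t * pol t * lam * h σ t) t) :
    (∀ t ∈ Set.Icc (0:ℝ) 1, 0 ≤ -μ t ∧ -μ t ≤ (β - α) * (1 - t)) ∧
    (∃ M : ℝ, ∀ t ∈ Set.Icc (0:ℝ) 1, |μ t| ≤ M) := by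
  have hneg : ∀ t ∈ Set.Icc (0:ℝ) 1, μ t ≤ 0 := by
    intro t0 ht0
    by_contra hcon
    push Not at hcon
    have hc0 : ContinuousOn μ (Set.Icc t0 1) := hμc.mono (Set.Icc_subset_Icc_left ht0.1)
    have hcl : IsClosed (Set.Icc t0 1 ∩ μ ⁻¹' Set.Iic 0) :=
      hc0.preimage_isClosed_of_isClosed isClosed_Icc isClosed_Iic
    have hcomp : IsCompact (Set.Icc t0 1 ∩ μ ⁻¹' Set.Iic 0) :=
      isCompact_Icc.of_isClosed_subset hcl Set.inter_subset_left
    obtain ⟨s, ⟨hs, hsμ⟩, hmin⟩ := hcomp.exists_isLeast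
      ⟨1, ⟨ht0.2, le_refl _⟩, by simp [hμ1]⟩
    have hsμ' : μ s ≤ 0 := hsμ
    have := mono_off_finset μ P t0 s hs.1 (hc0.mono (Set.Icc_subset_Icc_right hs.2)) (by
      intro t ht htP
      have ht01 : t ∈ Set.Ioo (0:ℝ) 1 := ⟨ht0.1.trans_lt ht.1, ht.2.trans_le hs.2⟩
      refine ⟨_, ?_, hode t ht01 htP⟩
      have hpt := hpol t ⟨ht01.1.le, ht01.2.le⟩
      have hh := h_nonneg_aux σ t hσ ht01.2.le
      have hpos : 0 ≤ μ t := by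
        by_contra hc
        push Not at hc
        have := hmin ⟨⟨ht.1.le, ht01.2.le⟩, hc.le⟩
        linarith [ht.2]
      have h1 : 0 ≤ β - α := by linarith
      have h2 : 0 ≤ 1 - pol t := by linarith [hpt.2]
      have h3 := hpt.1
      positivity)
    linarith
  have hmain : ∀ t ∈ Set.Icc (0:ℝ) 1, 0 ≤ -μ t ∧ -μ t ≤ (β - α) * (1 - t) := by
    intro t0 ht0
    refine ⟨by linarith [hneg t0 ht0], ?_⟩
    have hc0 : ContinuousOn μ (Set.Icc t0 1) := hμc.mono (Set.Icc_subset_Icc_left ht0.1)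
    have := mono_off_finset (fun t => (β - α) * t - μ t) P t0 1 ht0.2
      (by fun_prop) (by
      intro t ht htP
      have ht01 : t ∈ Set.Ioo (0:ℝ) 1 := ⟨ht0.1.trans_lt ht.1, ht.2⟩
      refine ⟨_, ?_, ((hasDerivAt_id t).const_mul (β - α)).sub (hode t ht01 htP)⟩
      have hpt := hpol t ⟨ht01.1.le, ht01.2.le⟩
      have hh := h_nonneg_aux σ t hσ ht01.2.le
      have hn : 0 ≤ -μ t := by linarith [hneg t ⟨ht01.1.le, ht01.2.le⟩]
      have h1 : 0 ≤ β - α := by linarith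
      have h3 := hpt.1
      have e1 : 0 ≤ (β - α) * pol t := by positivity
      have e2 : 0 ≤ (-μ t) * pol t * lam * h σ t := by positivity
      linarith)
    simp only [hμ1] at this
    linarith
  refine ⟨hmain, β - α, fun t ht => ?_⟩
  obtain ⟨h1, h2⟩ := hmain t ht
  rw [abs_of_nonpos (by linarith)]
  have : 0 ≤ (β - α) * t := mul_nonneg (by linarith) ht.1
  linarith
end

section
/- (Analytic core of Lemma 3.) Let σ > 0 and set η(σ) = −h′(0)/h(0)² = σ·exp(−σ²/8)/(√(2π)·(2Φ(σ/2) − 1)²). If 0 < λ < η(σ), then h′(t) + λ·h(t)² < 0 for all t ∈ [0,1], and consequently the function t ↦ h(t)·e^{λ·g(t)} is strictly decreasing on [0,1]. -/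
lemma aux_phi_eq (x : ℝ) : Phi x = 1 / 2 +
    (Real.sqrt (2 * Real.pi))⁻¹ * ∫ u in (0:ℝ)..x, Real.exp (-u ^ 2 / 2) := by
  have h0 : ∫ u in Set.Iic (0:ℝ), Real.exp (-u ^ 2 / 2) = Real.sqrt (2 * Real.pi) / 2 := by
    have h1 := integral_gaussian_Ioi (1/2)
    have h2 := integral_comp_neg_Iic (0:ℝ) (fun u : ℝ => Real.exp (-(1/2) * u ^ 2))
    rw [neg_zero, h1] at h2
    have h3 : Real.pi / (1/2) = 2 * Real.pi := by ring
    rw [h3] at h2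
    rw [← h2]
    congr 1
    funext u
    congr 1; ring
  have h4 := intervalIntegral.integral_Iic_sub_Iic (μ := MeasureTheory.volume) (a := (0:ℝ)) (b := x)
    aux_integrable.integrableOn aux_integrable.integrableOn
  have h5 : Real.sqrt (2 * Real.pi) ≠ 0 := by positivity
  unfold Phi
  rw [← h4, h0]
  field_simp
  ring

lemma aux_phi_deriv (x : ℝ) : HasDerivAt Phi
    ((Real.sqrt (2 * Real.pi))⁻¹ * Real.exp (-x ^ 2 / 2)) x := by
  have hc : Continuous (fun u : ℝ => Real.exp (-u ^ 2 / 2)) := by fun_prop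
  have h1 := (hc.integral_hasStrictDerivAt 0 x).hasDerivAt
  have h2 := (h1.const_mul (Real.sqrt (2 * Real.pi))⁻¹).const_add (1/2)
  have : Phi = fun x => 1 / 2 +
    (Real.sqrt (2 * Real.pi))⁻¹ * ∫ u in (0:ℝ)..x, Real.exp (-u ^ 2 / 2) := funext aux_phi_eq
  rw [this]
  exact h2

lemma aux_h_deriv (σ t : ℝ) : HasDerivAt (h σ) (hDeriv σ t) t := by
  have h0 : HasDerivAt (fun t : ℝ => σ * (1 - t) / 2) (σ * (-1) / 2) t :=
    (((hasDerivAt_id t).const_sub 1).const_mul σ).div_const 2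
  have h1 := ((HasDerivAt.comp t (aux_phi_deriv _) h0).const_mul 2).sub_const 1
  refine h1.congr_deriv ?_
  unfold hDeriv
  have : -(σ * (1 - t) / 2) ^ 2 / 2 = -(σ ^ 2 * (1 - t) ^ 2) / 8 := by ring
  rw [this]
  ring

lemma aux_h_anti (σ : ℝ) (hσ : 0 < σ) : StrictAnti (h σ) := by
  refine strictAnti_of_deriv_neg fun t => ?_
  rw [(aux_h_deriv σ t).deriv]
  unfold hDeriv
  have : 0 < σ / Real.sqrt (2 * Real.pi) * Real.exp (-(σ ^ 2 * (1 - t) ^ 2) / 8) := by positivity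
  linarith

lemma aux_h_one (σ : ℝ) : h σ 1 = 0 := by
  unfold h
  rw [aux_phi_eq]
  simp

/-- Analytic core of Lemma 3: with `η(σ) = -h′(0)/h(0)² = σ e^{-σ²/8}/(√(2π)(2Φ(σ/2)-1)²)`,
if `0 < λ < η(σ)` then `h′(t) + λ h(t)² < 0` on `[0,1]` and `t ↦ h(t)e^{λ g(t)}` is strictly
decreasing on `[0,1]`. -/
theorem stmt_14 (σ lam : ℝ) (hσ : 0 < σ) (hlam : 0 < lam)
    (hlt : lam < -(hDeriv σ 0) / (h σ 0) ^ 2) :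
    -(hDeriv σ 0) / (h σ 0) ^ 2
      = σ * Real.exp (-(σ ^ 2) / 8)
        / (Real.sqrt (2 * Real.pi) * (2 * Phi (σ / 2) - 1) ^ 2) ∧
    (∀ t ∈ Set.Icc (0:ℝ) 1, hDeriv σ t + lam * (h σ t) ^ 2 < 0) ∧
    StrictAntiOn (fun t => h σ t * Real.exp (lam * g σ t)) (Set.Icc 0 1) := by
  have key : ∀ t ∈ Set.Icc (0:ℝ) 1, hDeriv σ t + lam * (h σ t) ^ 2 < 0 := by
    rintro t ⟨ht0, ht1⟩
    have a1 : 0 ≤ h σ t := by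
      have := (aux_h_anti σ hσ).antitone ht1
      rwa [aux_h_one] at this
    have a2 : h σ t ≤ h σ 0 := (aux_h_anti σ hσ).antitone ht0
    have a3 : 0 < h σ 0 := by
      have := aux_h_anti σ hσ (zero_lt_one)
      rwa [aux_h_one] at this
    have a4 : lam * (h σ 0) ^ 2 < -(hDeriv σ 0) := (lt_div_iff₀ (by positivity)).1 hlt
    have a5 : hDeriv σ t ≤ hDeriv σ 0 := by
      unfold hDeriv
      have b : Real.exp (-(σ ^ 2 * (1 - 0) ^ 2) / 8) ≤ Real.exp (-(σ ^ 2 * (1 - t) ^ 2) / 8) := by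
        apply Real.exp_le_exp.2
        have : (1 - t) ^ 2 ≤ (1 - 0) ^ 2 := by nlinarith
        have := mul_le_mul_of_nonneg_left this (sq_nonneg σ)
        linarith
      have c : 0 ≤ σ / Real.sqrt (2 * Real.pi) := by positivity
      have := mul_le_mul_of_nonneg_left b c
      linarith
    have a6 : lam * (h σ t) ^ 2 ≤ lam * (h σ 0) ^ 2 := by gcongr
    linarith
  refine ⟨?_, key, ?_⟩
  · have e1 : h σ 0 = 2 * Phi (σ / 2) - 1 := by unfold h; simp
    have e2 : -(hDeriv σ 0) = σ / Real.sqrt (2 * Real.pi) * Real.exp (-(σ ^ 2) / 8) := by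
      unfold hDeriv; simp
    rw [e1, e2, div_mul_eq_mul_div, div_div]
  · have hd : ∀ t, HasDerivAt (fun t => h σ t * Real.exp (lam * g σ t))
        (hDeriv σ t * Real.exp (lam * g σ t)
          + h σ t * (Real.exp (lam * g σ t) * (lam * h σ t))) t := by
      intro t
      have hg : HasDerivAt (g σ) (h σ t) t :=
        ((aux_h_cont σ).integral_hasStrictDerivAt 0 t).hasDerivAt
      exact (aux_h_deriv σ t).mul (hg.const_mul lam).exp
    refine strictAntiOn_of_deriv_neg (convex_Icc 0 1)
      (fun t _ => (hd t).continuousAt.continuousWithinAt) fun t ht => ?_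
    rw [(hd t).deriv]
    have := mul_neg_of_pos_of_neg (Real.exp_pos (lam * g σ t)) (key t (interior_subset ht))
    linarith
end
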